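/- Let K be an infinite field with char(K) ≠ 2, 3 and R = K[x1,…,x7]. Enumerate the 21 degree-2 monomials m_1,…,m_21 as: x7², x6x7, x5x7, x4x7, x3x7, x2x7, x1x7, x6², x5x6, x4x6, x3x6, x2x6, x1x6, x5², x4x5, x3x5, x2x5, x1x5, x4², x3x4, x2x4. For any choice of 109 scalars c_{i,j} ∈ K, let I_c ⊆ R be the ideal generated by: g_i = m_i − (c_{i,2}·x3² + c_{i,3}·x2x3 + c_{i,4}·x2² + c_{i,5}·x1x4 + c_{i,6}·x1x3) for i = 1,…,21, where additionally for i ∈ {7, 13, 18} (i.e. for m_i = x1x7, x1x6, x1x5) the term −c_{i,7}·x1x2 is included; together with g_22 = x1²x4, g_23 = x3³, g_24 = x2x3², g_25 = x1x3², g_26 = x2²x3, g_27 = x1x2x3, g_28 = x1²x3, g_29 = x2³, g_30 = x1x2², g_31 = x1²x2 − c_{31,1}·x1³, and g_32 = x1⁴. Then for every choice of the scalars c_{i,j}, the residue classes of the 16 monomials 1, x1, x2, x3, x4, x5, x6, x7, x1², x1x2, x1x3, x1x4, x2², x2x3, x3², x1³ form a K-basis of R/I_c; in particular dim_K R/I_c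 = 16. -/

import Mathlib

set_option maxHeartbeats 2000000

open MvPolynomial

/-- The 21 degree-two head monomials `x₇², x₆x₇, x₅x₇, x₄x₇, x₃x₇, x₂x₇, x₁x₇, x₆², x₅x₆,
x₄x₆, x₃x₆, x₂x₆, x₁x₆, x₅², x₄x₅, x₃x₅, x₂x₅, x₁x₅, x₄², x₃x₄, x₂x₄`
(here `x_i` is `X (i-1)`). -/
noncomputable def heads21 (K : Type) [Field K] : Fin 21 → MvPolynomial (Fin 7) K :=
  ![X 6 ^ 2, X 5 * X 6, X 4 * X 6, X 3 * X 6, X 2 * X 6, X 1 * X 6, X 0 * X 6,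
    X 5 ^ 2, X 4 * X 5, X 3 * X 5, X 2 * X 5, X 1 * X 5, X 0 * X 5,
    X 4 ^ 2, X 3 * X 4, X 2 * X 4, X 1 * X 4, X 0 * X 4,
    X 3 ^ 2, X 2 * X 3, X 1 * X 3]

/-- The generator with head monomial `m_i`:
`g_i = m_i − (c_{i,2}·x₃² + c_{i,3}·x₂x₃ + c_{i,4}·x₂² + c_{i,5}·x₁x₄ + c_{i,6}·x₁x₃)`,
with the additional term `−c_{i,7}·x₁x₂` exactly when `m_i ∈ {x₁x₇, x₁x₆, x₁x₅}`
(i.e. `i = 7, 13, 18` in the 1-based enumeration). Here `c i 0, …, c i 4` stand for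
`c_{i,2}, …, c_{i,6}` and `c7, c13, c18` for the three extra parameters. -/
noncomputable def markedGen (K : Type) [Field K] (c : Fin 21 → Fin 5 → K)
    (c7 c13 c18 : K) (i : Fin 21) : MvPolynomial (Fin 7) K :=
  heads21 K i
    - (C (c i 0) * X 2 ^ 2 + C (c i 1) * (X 1 * X 2) + C (c i 2) * X 1 ^ 2
        + C (c i 3) * (X 0 * X 3) + C (c i 4) * (X 0 * X 2))
    - (if i = (6 : Fin 21) then C c7
        else if i = (12 : Fin 21) then C c13
        else if i = (17 : Fin 21) then C c18 else 0) * (X 0 * X 1)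

/-- The ideal `I_c` generated by `g₁,…,g₂₁` together with
`x₁²x₄, x₃³, x₂x₃², x₁x₃², x₂²x₃, x₁x₂x₃, x₁²x₃, x₂³, x₁x₂², x₁²x₂ − c₃₁·x₁³, x₁⁴`. -/
noncomputable def markedIdeal (K : Type) [Field K] (c : Fin 21 → Fin 5 → K)
    (c7 c13 c18 c31 : K) : Ideal (MvPolynomial (Fin 7) K) :=
  Ideal.span (Set.range (markedGen K c c7 c13 c18) ∪
    {X 0 ^ 2 * X 3, X 2 ^ 3, X 1 * X 2 ^ 2, X 0 * X 2 ^ 2, X 1 ^ 2 * X 2,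
     X 0 * X 1 * X 2, X 0 ^ 2 * X 2, X 1 ^ 3, X 0 * X 1 ^ 2,
     X 0 ^ 2 * X 1 - C c31 * X 0 ^ 3, X 0 ^ 4})

/-- The 16 monomials `1, x₁,…,x₇, x₁², x₁x₂, x₁x₃, x₁x₄, x₂², x₂x₃, x₃², x₁³`. -/
noncomputable def mons16 (K : Type) [Field K] : Fin 16 → MvPolynomial (Fin 7) K :=
  ![1, X 0, X 1, X 2, X 3, X 4, X 5, X 6, X 0 ^ 2, X 0 * X 1, X 0 * X 2, X 0 * X 3,
    X 1 ^ 2, X 1 * X 2, X 2 ^ 2, X 0 ^ 3]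

/-- Two bilinear pairings `V × V → W` and `V × W → K` for which the graded space `V ⊕ W ⊕ K`
(in degrees one, two and three) is a commutative associative algebra without unit. -/
structure CubicPairing (K V W : Type) [Field K] [AddCommGroup V] [Module K V]
    [AddCommGroup W] [Module K W] where
  /-- The product of two elements of degree one. -/
  quad : V →ₗ[K] V →ₗ[K] W
  /-- The product of an element of degree one and an element of degree two. -/
  cub : V →ₗ[K] W →ₗ[K] K
  quad_comm : ∀ u v, quad u v = quad v u
  cub_quad_comm : ∀ u v w, cub u (quad v w) = cub w (quad u v)

namespace CubicPairing

variable {K V W : Type} [Field K] [AddCommGroup V] [Module K V] [AddCommGroup W] [Module K W]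

/-- The graded algebra `V ⊕ W ⊕ K` of a cubic pairing. -/
@[ext]
structure Nil (D : CubicPairing K V W) where
  /-- The component of degree one. -/
  one : V
  /-- The component of degree two. -/
  two : W
  /-- The component of degree three. -/
  three : K

variable (D : CubicPairing K V W)

/-- The identification of the algebra of a cubic pairing with its underlying space. -/
def equivProd : D.Nil ≃ V × W × K where
  toFun a := (a.one, a.two, a.three)
  invFun a := ⟨a.1, a.2.1, a.2.2⟩

instance : AddCommGroup D.Nil := D.equivProd.addCommGroup

instance : Module K D.Nil := D.equivProd.module K

instance : Mul D.Nil :=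
  ⟨fun a b => ⟨0, D.quad a.one b.one, D.cub a.one b.two + D.cub b.one a.two⟩⟩

theorem mul_def (a b : D.Nil) :
    a * b = ⟨0, D.quad a.one b.one, D.cub a.one b.two + D.cub b.one a.two⟩ := rfl

theorem add_def (a b : D.Nil) :
    a + b = ⟨a.one + b.one, a.two + b.two, a.three + b.three⟩ := rfl

theorem zero_def : (0 : D.Nil) = ⟨0, 0, 0⟩ := rfl

theorem smul_def (r : K) (a : D.Nil) :
    r • a = ⟨r • a.one, r • a.two, r * a.three⟩ := rfl

protected theorem mul_comm (a b : D.Nil) : a * b = b * a := by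
  simp only [mul_def, D.quad_comm a.one b.one, add_comm]

protected theorem mul_add (a b c : D.Nil) : a * (b + c) = a * b + a * c := by
  simp only [mul_def, add_def, map_add, LinearMap.add_apply, add_zero]
  congr 1
  ring

protected theorem mul_zero (a : D.Nil) : a * 0 = 0 := by
  simp [mul_def, zero_def]

instance : NonUnitalCommRing D.Nil where
  mul_comm := D.mul_comm
  left_distrib := D.mul_add
  right_distrib a b c := by
    rw [D.mul_comm, D.mul_add, D.mul_comm c a, D.mul_comm c b]
  mul_zero := D.mul_zero
  zero_mul a := by rw [D.mul_comm, D.mul_zero]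
  mul_assoc a b c := by
    simp only [mul_def, map_zero, LinearMap.zero_apply, zero_add, add_zero]
    rw [D.cub_quad_comm a.one b.one c.one]

instance : IsScalarTower K D.Nil D.Nil :=
  ⟨fun r a b => by
    simp only [mul_def, smul_def, smul_eq_mul, map_smul, LinearMap.smul_apply, smul_zero, mul_add]⟩

instance : SMulCommClass K D.Nil D.Nil :=
  ⟨fun r a b => by
    simp only [mul_def, smul_def, smul_eq_mul, map_smul, LinearMap.smul_apply, smul_zero, mul_add]⟩

end CubicPairing

/-- The index of the first variable in each of the 21 head monomials. -/
def headFst : Fin 21 → Fin 7 :=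
  ![6, 5, 4, 3, 2, 1, 0, 5, 4, 3, 2, 1, 0, 4, 3, 2, 1, 0, 3, 2, 1]

/-- The index of the second variable in each of the 21 head monomials. -/
def headSnd : Fin 21 → Fin 7 :=
  ![6, 6, 6, 6, 6, 6, 6, 5, 5, 5, 5, 5, 5, 4, 4, 4, 4, 4, 3, 3, 3]

/-- The coefficient of `x_i x_j` in the product of two linear forms. -/
def prodCoeff {K : Type} [Field K] (i j : Fin 7) (u v : Fin 7 → K) : K :=
  if i = j then u i * v i else u i * v j + u j * v i

section prodCoeff

variable {K : Type} [Field K] (i j : Fin 7)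

theorem prodCoeff_comm (u v : Fin 7 → K) : prodCoeff i j u v = prodCoeff i j v u := by
  unfold prodCoeff; split_ifs <;> ring

theorem prodCoeff_add (u v w : Fin 7 → K) :
    prodCoeff i j u (v + w) = prodCoeff i j u v + prodCoeff i j u w := by
  unfold prodCoeff; split_ifs <;> simp only [Pi.add_apply] <;> ring

theorem prodCoeff_smul (r : K) (u v : Fin 7 → K) :
    prodCoeff i j u (r • v) = r * prodCoeff i j u v := by
  unfold prodCoeff; split_ifs <;> simp only [Pi.smul_apply, smul_eq_mul] <;> ring

theorem prodCoeff_single (a b : Fin 7) :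
    prodCoeff i j (Pi.single a 1 : Fin 7 → K) (Pi.single b 1) =
      if (i = a ∧ j = b) ∨ (i = b ∧ j = a) then 1 else 0 := by
  simp only [prodCoeff, Pi.single_apply]
  split_ifs <;> simp_all

end prodCoeff

section MarkedAlgebra

variable {K : Type} [Field K] (c : Fin 21 → Fin 5 → K) (c7 c13 c18 c31 : K)

/-- The coordinates of the product of two linear forms modulo `I_c`, with respect to
`x₁², x₁x₂, x₁x₃, x₁x₄, x₂², x₂x₃, x₃²`. -/
def quadFun (u v : Fin 7 → K) : Fin 7 → K :=
  let r : Fin 5 → K := fun k => ∑ i, c i k * prodCoeff (headFst i) (headSnd i) u v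
  ![prodCoeff 0 0 u v,
    prodCoeff 0 1 u v + c18 * prodCoeff 0 4 u v + c13 * prodCoeff 0 5 u v
      + c7 * prodCoeff 0 6 u v,
    prodCoeff 0 2 u v + r 4, prodCoeff 0 3 u v + r 3, prodCoeff 1 1 u v + r 2,
    prodCoeff 1 2 u v + r 1, prodCoeff 2 2 u v + r 0]

theorem quadFun_comm (u v : Fin 7 → K) :
    quadFun c c7 c13 c18 u v = quadFun c c7 c13 c18 v u := by
  simp only [quadFun, prodCoeff_comm _ _ u v]

theorem quadFun_add (u v w : Fin 7 → K) :
    quadFun c c7 c13 c18 u (v + w) = quadFun c c7 c13 c18 u v + quadFun c c7 c13 c18 u w := by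
  ext k
  fin_cases k <;>
    simp [quadFun, prodCoeff_add, mul_add, Finset.sum_add_distrib] <;> ring

theorem quadFun_smul (r : K) (u v : Fin 7 → K) :
    quadFun c c7 c13 c18 u (r • v) = r • quadFun c c7 c13 c18 u v := by
  ext k
  fin_cases k <;>
    simp [quadFun, prodCoeff_smul, mul_add, Finset.mul_sum, mul_left_comm]

/-- The linear form recording how the variables act on `x₁²`, up to the factor `c₃₁`. -/
def sqForm (v : Fin 7 → K) : K := v 1 + c18 * v 4 + c13 * v 5 + c7 * v 6

/-- The pairing whose algebra is the augmentation ideal of `R/I_c`. -/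
def markedPairing : CubicPairing K (Fin 7 → K) (Fin 7 → K) where
  quad := LinearMap.mk₂ K (quadFun c c7 c13 c18)
    (fun u v w => by
      rw [quadFun_comm, quadFun_add, quadFun_comm _ _ _ _ w u, quadFun_comm _ _ _ _ w v])
    (fun r u v => by rw [quadFun_comm, quadFun_smul, quadFun_comm _ _ _ _ v u])
    (quadFun_add c c7 c13 c18)
    (fun r u v => quadFun_smul c c7 c13 c18 r u v)
  cub := LinearMap.mk₂ K
    (fun v w => v 0 * (w 0 + c31 * w 1) + c31 * sqForm c7 c13 c18 v * w 0)
    (fun u v w => by simp only [sqForm, Pi.add_apply]; ring)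
    (fun r u v => by simp only [sqForm, Pi.smul_apply, smul_eq_mul]; ring)
    (fun u v w => by simp only [Pi.add_apply]; ring)
    (fun r u v => by simp only [Pi.smul_apply, smul_eq_mul]; ring)
  quad_comm u v := quadFun_comm c c7 c13 c18 u v
  cub_quad_comm u v w := by
    simp [quadFun, prodCoeff, sqForm]
    ring

/-- The element of the algebra of `markedPairing` with the given components. -/
def comp (v w : Fin 7 → K) (t : K) : Unitization K (markedPairing c c7 c13 c18 c31).Nil :=
  Unitization.inr ⟨v, w, t⟩

/-- The evaluation of polynomials in the algebra of `markedPairing`. -/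
noncomputable def markedEval :
    MvPolynomial (Fin 7) K →ₐ[K] Unitization K (markedPairing c c7 c13 c18 c31).Nil :=
  aeval fun i => comp c c7 c13 c18 c31 (Pi.single i 1) 0 0

theorem comp_mul (v w v' w' : Fin 7 → K) (t t' : K) :
    comp c c7 c13 c18 c31 v w t * comp c c7 c13 c18 c31 v' w' t' =
      comp c c7 c13 c18 c31 0 (quadFun c c7 c13 c18 v v')
        (v 0 * (w' 0 + c31 * w' 1) + c31 * sqForm c7 c13 c18 v * w' 0
          + (v' 0 * (w 0 + c31 * w 1) + c31 * sqForm c7 c13 c18 v' * w 0)) := by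
  rw [comp, comp, ← Unitization.inr_mul]
  rfl

theorem comp_add (v w v' w' : Fin 7 → K) (t t' : K) :
    comp c c7 c13 c18 c31 v w t + comp c c7 c13 c18 c31 v' w' t' =
      comp c c7 c13 c18 c31 (v + v') (w + w') (t + t') := by
  rw [comp, comp, ← Unitization.inr_add]
  rfl

theorem comp_smul (r : K) (v w : Fin 7 → K) (t : K) :
    r • comp c c7 c13 c18 c31 v w t = comp c c7 c13 c18 c31 (r • v) (r • w) (r * t) := by
  rw [comp, ← Unitization.inr_smul]
  rfl

theorem comp_sub (v w v' w' : Fin 7 → K) (t t' : K) :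
    comp c c7 c13 c18 c31 v w t - comp c c7 c13 c18 c31 v' w' t' =
      comp c c7 c13 c18 c31 (v - v') (w - w') (t - t') := by
  rw [comp, comp, ← Unitization.inr_sub]
  rfl

theorem comp_zero : comp c c7 c13 c18 c31 0 0 0 = 0 := Unitization.inr_zero _

theorem quadFun_single_head (i : Fin 21) :
    quadFun c c7 c13 c18 (Pi.single (headFst i) 1) (Pi.single (headSnd i) 1) =
      ![0, if i = 6 then c7 else if i = 12 then c13 else if i = 17 then c18 else 0,
        c i 4, c i 3, c i 2, c i 1, c i 0] := by
  have key : ∀ i j : Fin 21, (headFst j = headFst i ∧ headSnd j = headSnd i ∨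
      headFst j = headSnd i ∧ headSnd j = headFst i) ↔ j = i := by decide
  simp only [quadFun, prodCoeff_single, key]
  simp only [mul_ite, mul_one, mul_zero, Finset.sum_ite_eq', Finset.mem_univ, if_true]
  fin_cases i <;> simp [headFst, headSnd]

theorem quadFun_single_basis (k : Fin 7) :
    quadFun c c7 c13 c18 (Pi.single (![0, 0, 0, 0, 1, 1, 2] k) 1)
      (Pi.single (![0, 1, 2, 3, 1, 2, 2] k) 1) = Pi.single k 1 := by
  have key : ∀ (k : Fin 7) (i : Fin 21), ¬ (
      headFst i = ![0, 0, 0, 0, 1, 1, 2] k ∧ headSnd i = ![0, 1, 2, 3, 1, 2, 2] k ∨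
      headFst i = ![0, 1, 2, 3, 1, 2, 2] k ∧ headSnd i = ![0, 0, 0, 0, 1, 1, 2] k) := by
    decide
  simp only [quadFun, prodCoeff_single, key]
  ext j
  fin_cases k <;> fin_cases j <;> simp

theorem quadFun_apply_zero (u v : Fin 7 → K) : quadFun c c7 c13 c18 u v 0 = u 0 * v 0 := by
  simp [quadFun, prodCoeff]

theorem quadFun_apply_one (u v : Fin 7 → K) :
    quadFun c c7 c13 c18 u v 1 = u 0 * sqForm c7 c13 c18 v + v 0 * sqForm c7 c13 c18 u := by
  simp [quadFun, prodCoeff, sqForm]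
  ring

theorem quadFun_zero (v : Fin 7 → K) : quadFun c c7 c13 c18 v 0 = 0 := by
  simpa using quadFun_smul c c7 c13 c18 0 v 0

theorem zero_quadFun (v : Fin 7 → K) : quadFun c c7 c13 c18 0 v = 0 := by
  rw [quadFun_comm, quadFun_zero]

theorem markedEval_X (i : Fin 7) :
    markedEval c c7 c13 c18 c31 (X i) = comp c c7 c13 c18 c31 (Pi.single i 1) 0 0 := by
  simp [markedEval]

theorem markedEval_X_mul_X (i j : Fin 7) :
    markedEval c c7 c13 c18 c31 (X i * X j) =
      comp c c7 c13 c18 c31 0 (quadFun c c7 c13 c18 (Pi.single i 1) (Pi.single j 1)) 0 := by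
  simp [markedEval_X, comp_mul]

theorem markedEval_basis (k : Fin 7) :
    markedEval c c7 c13 c18 c31 (X (![0, 0, 0, 0, 1, 1, 2] k) * X (![0, 1, 2, 3, 1, 2, 2] k)) =
      comp c c7 c13 c18 c31 0 (Pi.single k 1) 0 := by
  rw [markedEval_X_mul_X, quadFun_single_basis]

theorem heads21_eq (i : Fin 21) : heads21 K i = X (headFst i) * X (headSnd i) := by
  fin_cases i <;> simp [heads21, headFst, headSnd, sq]

theorem markedEval_markedGen (i : Fin 21) :
    markedEval c c7 c13 c18 c31 (markedGen K c c7 c13 c18 i) = 0 := by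
  have h1 := markedEval_basis c c7 c13 c18 c31 1
  have h2 := markedEval_basis c c7 c13 c18 c31 2
  have h3 := markedEval_basis c c7 c13 c18 c31 3
  have h4 := markedEval_basis c c7 c13 c18 c31 4
  have h5 := markedEval_basis c c7 c13 c18 c31 5
  have h6 := markedEval_basis c c7 c13 c18 c31 6
  simp only [Matrix.cons_val] at h1 h2 h3 h4 h5 h6
  have hC : (if i = (6 : Fin 21) then C c7 else if i = (12 : Fin 21) then C c13
      else if i = (17 : Fin 21) then C c18 else 0 : MvPolynomial (Fin 7) K) =
      C (if i = 6 then c7 else if i = 12 then c13 else if i = 17 then c18 else 0) := by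
    split_ifs <;> simp
  rw [markedGen, hC, heads21_eq, sq, sq]
  simp only [map_sub, map_add, C_mul', map_smul]
  rw [markedEval_X_mul_X, quadFun_single_head, h1, h2, h3, h4, h5, h6]
  generalize (if i = 6 then c7 else if i = 12 then c13 else if i = 17 then c18 else 0) = d
  simp only [comp_smul, comp_add, comp_sub]
  convert comp_zero c c7 c13 c18 c31 using 2
  · simp
  · ext j
    simp only [Pi.sub_apply, Pi.add_apply, Pi.smul_apply, Pi.single_apply, Pi.zero_apply]
    fin_cases j <;> simp
  · simp

theorem markedIdeal_le_ker :
    markedIdeal K c c7 c13 c18 c31 ≤ RingHom.ker (markedEval c c7 c13 c18 c31) := by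
  rw [markedIdeal, Ideal.span_le]
  rintro p (⟨i, rfl⟩ | hp)
  · exact markedEval_markedGen c c7 c13 c18 c31 i
  · simp only [Set.mem_insert_iff, Set.mem_singleton_iff] at hp
    simp only [SetLike.mem_coe, RingHom.mem_ker]
    rcases hp with rfl | rfl | rfl | rfl | rfl | rfl | rfl | rfl | rfl | rfl | rfl <;>
    simp [markedEval_X, pow_succ, C_mul', comp_mul, comp_smul, quadFun_apply_zero,
      quadFun_apply_one, sqForm, comp_zero, zero_quadFun, quadFun_zero]

theorem linearIndependent_markedEval_mons16 :
    LinearIndependent K fun i => markedEval c c7 c13 c18 c31 (mons16 K i) := by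
  rw [Fintype.linearIndependent_iff]
  intro g hg
  have h0 := markedEval_basis c c7 c13 c18 c31 0
  have h1 := markedEval_basis c c7 c13 c18 c31 1
  have h2 := markedEval_basis c c7 c13 c18 c31 2
  have h3 := markedEval_basis c c7 c13 c18 c31 3
  have h4 := markedEval_basis c c7 c13 c18 c31 4
  have h5 := markedEval_basis c c7 c13 c18 c31 5
  have h6 := markedEval_basis c c7 c13 c18 c31 6
  simp only [Matrix.cons_val] at h0 h1 h2 h3 h4 h5 h6
  have h7 : markedEval c c7 c13 c18 c31 (X 0 ^ 3) = comp c c7 c13 c18 c31 0 0 1 := by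
    simp [markedEval_X, pow_succ, comp_mul, quadFun_apply_zero, quadFun_apply_one, sqForm,
      zero_quadFun]
  have hsum : ∑ i, g i • markedEval c c7 c13 c18 c31 (mons16 K i) =
      Unitization.inl (g 0) + comp c c7 c13 c18 c31 ![g 1, g 2, g 3, g 4, g 5, g 6, g 7]
        ![g 8, g 9, g 10, g 11, g 12, g 13, g 14] (g 15) := by
    have hone : g 0 • (1 : Unitization K (markedPairing c c7 c13 c18 c31).Nil) =
        Unitization.inl (g 0) := by
      rw [← Algebra.algebraMap_eq_smul_one]
      rfl
    simp only [Fin.sum_univ_succ, Fin.sum_univ_zero, mons16, add_zero, Matrix.cons_val_zero,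
      Matrix.cons_val_succ, Fin.succ_zero_eq_one, Fin.reduceSucc]
    simp only [map_one, sq, h0, h1, h2, h3, h4, h5, h6, h7, hone, markedEval_X, comp_smul, comp_add]
    congr 2
    · ext j
      simp only [Pi.add_apply, Pi.smul_apply, Pi.single_apply, Pi.zero_apply]
      fin_cases j <;> simp
    · ext j
      simp only [Pi.add_apply, Pi.smul_apply, Pi.single_apply, Pi.zero_apply]
      fin_cases j <;> simp
    · simp
  rw [hsum] at hg
  have hfst : g 0 = 0 := by simpa [comp] using congrArg (fun x => x.fst) hg
  rw [hfst, Unitization.inl_zero, zero_add, ← comp_zero] at hg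
  have hnil := Unitization.inr_injective hg
  simp only [CubicPairing.Nil.mk.injEq] at hnil
  obtain ⟨hone, htwo, hthree⟩ := hnil
  simp [funext_iff, Fin.forall_fin_succ] at hone htwo
  intro i
  fin_cases i <;> simp_all

end MarkedAlgebra

section Spanning

variable {K : Type} [Field K] (c : Fin 21 → Fin 5 → K) (c7 c13 c18 c31 : K)

/-- The residue classes of the variables modulo `I_c`. -/
noncomputable def markedVar (i : Fin 7) :
    MvPolynomial (Fin 7) K ⧸ markedIdeal K c c7 c13 c18 c31 :=
  Ideal.Quotient.mk _ (X i)

local notation "y" => markedVar c c7 c13 c18 c31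

/-- The span of the residue classes of `x₃², x₂x₃, x₂², x₁x₄, x₁x₃`. -/
noncomputable def tailSpan :
    Submodule K (MvPolynomial (Fin 7) K ⧸ markedIdeal K c c7 c13 c18 c31) :=
  Submodule.span K {y 2 ^ 2, y 1 * y 2, y 1 ^ 2, y 0 * y 3, y 0 * y 2}

/-- The coefficient of `x₁x₂` in the reduction of `X j * X k` modulo `I_c`, for `k ≠ 0`. -/
def crossCoeff (c7 c13 c18 : K) (j k : Fin 7) : K :=
  if j = 0 then ![0, 1, 0, 0, c18, c13, c7] k else 0

theorem mk_C_mul (r : K) (p : MvPolynomial (Fin 7) K) :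
    Ideal.Quotient.mk (markedIdeal K c c7 c13 c18 c31) (C r * p) =
      r • Ideal.Quotient.mk (markedIdeal K c c7 c13 c18 c31) p := by
  rw [C_mul']
  rfl

theorem head_sub_mem_tailSpan (i : Fin 21) :
    y (headFst i) * y (headSnd i) - crossCoeff c7 c13 c18 (headFst i) (headSnd i) • (y 0 * y 1)
      ∈ tailSpan c c7 c13 c18 c31 := by
  have hmem : Ideal.Quotient.mk (markedIdeal K c c7 c13 c18 c31)
      (markedGen K c c7 c13 c18 i) = 0 :=
    Ideal.Quotient.eq_zero_iff_mem.2 (Ideal.subset_span (Or.inl ⟨i, rfl⟩))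
  have hC : (if i = (6 : Fin 21) then C c7 else if i = (12 : Fin 21) then C c13
      else if i = (17 : Fin 21) then C c18 else 0 : MvPolynomial (Fin 7) K) =
      C (crossCoeff c7 c13 c18 (headFst i) (headSnd i)) := by
    fin_cases i <;> simp [crossCoeff, headFst, headSnd]
  rw [markedGen, hC, heads21_eq] at hmem
  simp only [map_sub, map_add, mk_C_mul] at hmem
  simp only [map_mul, map_pow] at hmem
  change y (headFst i) * y (headSnd i) - (c i 0 • y 2 ^ 2 + c i 1 • (y 1 * y 2) + c i 2 • y 1 ^ 2
    + c i 3 • (y 0 * y 3) + c i 4 • (y 0 * y 2))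
    - crossCoeff c7 c13 c18 (headFst i) (headSnd i) • (y 0 * y 1) = 0 at hmem
  rw [sub_right_comm, sub_eq_zero] at hmem
  rw [hmem, tailSpan]
  refine add_mem (add_mem (add_mem (add_mem ?_ ?_) ?_) ?_) ?_ <;>
  exact Submodule.smul_mem _ _ (Submodule.subset_span (by simp))

theorem mul_sub_mem_tailSpan (j k : Fin 7) (hk : k ≠ 0) :
    y j * y k - crossCoeff c7 c13 c18 j k • (y 0 * y 1) ∈ tailSpan c c7 c13 c18 c31 := by
  have key : ∀ j k : Fin 7, k ≠ 0 → (∃ i, headFst i = j ∧ headSnd i = k) ∨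
      (∃ i, headFst i = k ∧ headSnd i = j ∧ j ≠ 0) ∨ (j = 0 ∧ k = 1) ∨ (j = 0 ∧ k = 2) ∨
      (j = 0 ∧ k = 3) ∨ (j = 1 ∧ k = 1) ∨ (j = 1 ∧ k = 2) ∨ (j = 2 ∧ k = 1) ∨
      (j = 2 ∧ k = 2) := by decide
  rcases key j k hk with ⟨i, rfl, rfl⟩ | ⟨i, rfl, rfl, hj⟩ | h
  · exact head_sub_mem_tailSpan c c7 c13 c18 c31 i
  · have := head_sub_mem_tailSpan c c7 c13 c18 c31 i
    rw [crossCoeff, if_neg hk] at this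
    rwa [crossCoeff, if_neg hj, mul_comm]
  · rcases h with ⟨rfl, rfl⟩ | h
    · simp [crossCoeff]
    · rcases h with ⟨rfl, rfl⟩ | ⟨rfl, rfl⟩ | ⟨rfl, rfl⟩ | ⟨rfl, rfl⟩ | ⟨rfl, rfl⟩ | ⟨rfl, rfl⟩ <;>
      · simp only [crossCoeff]
        simp only [Matrix.cons_val, one_ne_zero, Fin.reduceEq, if_false, if_true, zero_smul,
          sub_zero]
        exact Submodule.subset_span (by simp [sq, mul_comm])

theorem mul_mem_tailSpan (j k : Fin 7) (hj : j ≠ 0) (hk : k ≠ 0) :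
    y j * y k ∈ tailSpan c c7 c13 c18 c31 := by
  simpa [crossCoeff, hj] using mul_sub_mem_tailSpan c c7 c13 c18 c31 j k hk

theorem cubic_relations :
    y 0 ^ 2 * y 3 = 0 ∧ y 2 ^ 3 = 0 ∧ y 1 * y 2 ^ 2 = 0 ∧ y 0 * y 2 ^ 2 = 0 ∧
    y 1 ^ 2 * y 2 = 0 ∧ y 0 * y 1 * y 2 = 0 ∧ y 0 ^ 2 * y 2 = 0 ∧ y 1 ^ 3 = 0 ∧
    y 0 * y 1 ^ 2 = 0 ∧ y 0 ^ 2 * y 1 = c31 • y 0 ^ 3 ∧ y 0 ^ 4 = 0 := by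
  have h : ∀ p ∈ ({X 0 ^ 2 * X 3, X 2 ^ 3, X 1 * X 2 ^ 2, X 0 * X 2 ^ 2, X 1 ^ 2 * X 2,
      X 0 * X 1 * X 2, X 0 ^ 2 * X 2, X 1 ^ 3, X 0 * X 1 ^ 2,
      X 0 ^ 2 * X 1 - C c31 * X 0 ^ 3, X 0 ^ 4} : Set (MvPolynomial (Fin 7) K)),
      Ideal.Quotient.mk (markedIdeal K c c7 c13 c18 c31) p = 0 := fun p hp =>
    Ideal.Quotient.eq_zero_iff_mem.2 (Ideal.subset_span (Or.inr hp))
  simp only [Set.mem_insert_iff, Set.mem_singleton_iff, forall_eq_or_imp, forall_eq, map_sub,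
    mk_C_mul, sub_eq_zero] at h
  simp only [map_mul, map_pow] at h
  exact h

theorem tailSpan_mul_zero (q : MvPolynomial (Fin 7) K ⧸ markedIdeal K c c7 c13 c18 c31)
    (hq : q ∈ tailSpan c c7 c13 c18 c31) : q * y 0 = 0 := by
  obtain ⟨h1, h2, h3, h4, h5, h6, h7, h8, h9, h10, h11⟩ := cubic_relations c c7 c13 c18 c31
  induction hq using Submodule.span_induction with
  | mem x hx =>
    simp only [Set.mem_insert_iff, Set.mem_singleton_iff] at hx
    rcases hx with rfl | rfl | rfl | rfl | rfl <;> grind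
  | zero => simp
  | add x z _ _ hx hz => rw [add_mul, hx, hz, add_zero]
  | smul r x _ hx => rw [smul_mul_assoc, hx, smul_zero]

theorem mul_mul_zero (j k : Fin 7) (hj : j ≠ 0) (hk : k ≠ 0) : y j * y k * y 0 = 0 :=
  tailSpan_mul_zero c c7 c13 c18 c31 _ (mul_mem_tailSpan c c7 c13 c18 c31 j k hj hk)

theorem tailSpan_mul_of_forall (j : Fin 7) (hj : j ≠ 0) (h1 : y 1 ^ 2 * y j = 0)
    (h2 : y 1 * y 2 * y j = 0) (h3 : y 2 ^ 2 * y j = 0)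
    (q : MvPolynomial (Fin 7) K ⧸ markedIdeal K c c7 c13 c18 c31)
    (hq : q ∈ tailSpan c c7 c13 c18 c31) : q * y j = 0 := by
  have h4 := mul_mul_zero c c7 c13 c18 c31 3 j (by decide) hj
  have h5 := mul_mul_zero c c7 c13 c18 c31 2 j (by decide) hj
  induction hq using Submodule.span_induction with
  | mem x hx =>
    simp only [Set.mem_insert_iff, Set.mem_singleton_iff] at hx
    rcases hx with rfl | rfl | rfl | rfl | rfl <;> grind
  | zero => simp
  | add x z _ _ hx hz => rw [add_mul, hx, hz, add_zero]
  | smul r x _ hx => rw [smul_mul_assoc, hx, smul_zero]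

theorem tailSpan_mul (j : Fin 7)
    (q : MvPolynomial (Fin 7) K ⧸ markedIdeal K c c7 c13 c18 c31)
    (hq : q ∈ tailSpan c c7 c13 c18 c31) : q * y j = 0 := by
  obtain ⟨-, h2, h3, -, h5, -, -, h8, -, -, -⟩ := cubic_relations c c7 c13 c18 c31
  by_cases hj : j = 0
  · rw [hj]
    exact tailSpan_mul_zero c c7 c13 c18 c31 q hq
  have hone : ∀ q ∈ tailSpan c c7 c13 c18 c31, q * y 1 = 0 :=
    tailSpan_mul_of_forall c c7 c13 c18 c31 1 (by decide) (by rw [← h8]; ring)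
      (by rw [← h5]; ring) (by rw [← h3]; ring)
  have htwo : ∀ q ∈ tailSpan c c7 c13 c18 c31, q * y 2 = 0 :=
    tailSpan_mul_of_forall c c7 c13 c18 c31 2 (by decide) h5
      (by rw [← h3]; ring) (by rw [← h2]; ring)
  have m1 := mul_mem_tailSpan c c7 c13 c18 c31 1 j (by decide) hj
  have m2 := mul_mem_tailSpan c c7 c13 c18 c31 2 j (by decide) hj
  refine tailSpan_mul_of_forall c c7 c13 c18 c31 j hj ?_ ?_ ?_ q hq
  · rw [← hone _ m1]; ring
  · rw [← htwo _ m1]; ring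
  · rw [← htwo _ m2]; ring

theorem sq_mul (k : Fin 7) (hk : k ≠ 0) :
    y 0 ^ 2 * y k = (crossCoeff c7 c13 c18 0 k * c31) • y 0 ^ 3 := by
  obtain ⟨-, -, -, -, -, -, -, -, -, h10, -⟩ := cubic_relations c c7 c13 c18 c31
  have h := tailSpan_mul_zero c c7 c13 c18 c31 _ (mul_sub_mem_tailSpan c c7 c13 c18 c31 0 k hk)
  rw [sub_mul, sub_eq_zero, smul_mul_assoc] at h
  rw [mul_smul, ← h10, sq, mul_assoc, mul_comm, h]
  congr 1
  ring

theorem cube_mul (k : Fin 7) : y 0 ^ 3 * y k = 0 := by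
  obtain ⟨-, -, -, -, -, -, -, -, -, -, h11⟩ := cubic_relations c c7 c13 c18 c31
  by_cases hk : k = 0
  · rw [hk, ← h11]; ring
  · have : y 0 ^ 3 * y k = y 0 * (y 0 ^ 2 * y k) := by ring
    rw [this, sq_mul c c7 c13 c18 c31 k hk, mul_smul_comm, ← pow_succ', h11, smul_zero]

/-- The span of the residue classes of the 16 monomials. -/
noncomputable def monsSpan :
    Submodule K (MvPolynomial (Fin 7) K ⧸ markedIdeal K c c7 c13 c18 c31) :=
  Submodule.span K
    (Set.range fun i => Ideal.Quotient.mk (markedIdeal K c c7 c13 c18 c31) (mons16 K i))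

local notation "S" => monsSpan c c7 c13 c18 c31

theorem mons_mem (i : Fin 16) :
    Ideal.Quotient.mk (markedIdeal K c c7 c13 c18 c31) (mons16 K i) ∈ S :=
  Submodule.subset_span ⟨i, rfl⟩

theorem tailSpan_le_monsSpan : tailSpan c c7 c13 c18 c31 ≤ S := by
  rw [tailSpan, Submodule.span_le]
  rintro x (rfl | rfl | rfl | rfl | rfl)
  · exact mons_mem c c7 c13 c18 c31 14
  · exact mons_mem c c7 c13 c18 c31 13
  · exact mons_mem c c7 c13 c18 c31 12
  · exact mons_mem c c7 c13 c18 c31 11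
  · exact mons_mem c c7 c13 c18 c31 10

theorem var_mem (j : Fin 7) : y j ∈ S := by
  fin_cases j
  · exact mons_mem c c7 c13 c18 c31 1
  · exact mons_mem c c7 c13 c18 c31 2
  · exact mons_mem c c7 c13 c18 c31 3
  · exact mons_mem c c7 c13 c18 c31 4
  · exact mons_mem c c7 c13 c18 c31 5
  · exact mons_mem c c7 c13 c18 c31 6
  · exact mons_mem c c7 c13 c18 c31 7

theorem var_mul_var_mem (j k : Fin 7) : y j * y k ∈ S := by
  have h01 : y 0 * y 1 ∈ S := mons_mem c c7 c13 c18 c31 9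
  have aux : ∀ j k : Fin 7, k ≠ 0 → y j * y k ∈ S := fun j k hk => by
    have h := tailSpan_le_monsSpan c c7 c13 c18 c31 (mul_sub_mem_tailSpan c c7 c13 c18 c31 j k hk)
    simpa using add_mem h (Submodule.smul_mem _ (crossCoeff c7 c13 c18 j k) h01)
  by_cases hk : k = 0
  · by_cases hj : j = 0
    · rw [hj, hk, ← sq]
      exact mons_mem c c7 c13 c18 c31 8
    · rw [mul_comm]
      exact aux k j hj
  · exact aux j k hk

theorem mons_mul_var_mem (i : Fin 16) (j : Fin 7) :
    Ideal.Quotient.mk (markedIdeal K c c7 c13 c18 c31) (mons16 K i) * y j ∈ S := by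
  obtain ⟨-, -, -, -, -, -, -, -, -, h10, -⟩ := cubic_relations c c7 c13 c18 c31
  have hcube : y 0 ^ 3 ∈ S := mons_mem c c7 c13 c18 c31 15
  have htail : ∀ q ∈ tailSpan c c7 c13 c18 c31, q * y j ∈ S := fun q hq => by
    rw [tailSpan_mul c c7 c13 c18 c31 j q hq]
    exact zero_mem _
  have hvar : ∀ k, y k * y j ∈ S := fun k => var_mul_var_mem c c7 c13 c18 c31 k j
  have hsq : y 0 ^ 2 * y j ∈ S := by
    by_cases hj : j = 0
    · rwa [hj, ← pow_succ]
    · rw [sq_mul c c7 c13 c18 c31 j hj]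
      exact Submodule.smul_mem _ _ hcube
  have hcross : y 0 * y 1 * y j ∈ S := by
    by_cases hj : j = 0
    · rw [hj, mul_right_comm, ← sq, h10]
      exact Submodule.smul_mem _ _ hcube
    · rw [mul_assoc, mul_comm, mul_mul_zero c c7 c13 c18 c31 1 j (by decide) hj]
      exact zero_mem _
  have hcub : y 0 ^ 3 * y j ∈ S := by
    rw [cube_mul]
    exact zero_mem _
  fin_cases i
  · simpa [mons16] using var_mem c c7 c13 c18 c31 j
  · exact hvar 0
  · exact hvar 1
  · exact hvar 2
  · exact hvar 3
  · exact hvar 4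
  · exact hvar 5
  · exact hvar 6
  · exact hsq
  · exact hcross
  · exact htail (y 0 * y 2) (Submodule.subset_span (by simp))
  · exact htail (y 0 * y 3) (Submodule.subset_span (by simp))
  · exact htail (y 1 ^ 2) (Submodule.subset_span (by simp))
  · exact htail (y 1 * y 2) (Submodule.subset_span (by simp))
  · exact htail (y 2 ^ 2) (Submodule.subset_span (by simp))
  · exact hcub

theorem monsSpan_eq_top : S = ⊤ := by
  rw [eq_top_iff]
  rintro x -
  obtain ⟨p, rfl⟩ := Ideal.Quotient.mk_surjective x
  induction p using MvPolynomial.induction_on with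
  | C a =>
    have := mk_C_mul c c7 c13 c18 c31 a 1
    rw [mul_one] at this
    rw [this]
    exact Submodule.smul_mem _ _ (mons_mem c c7 c13 c18 c31 0)
  | add p q hp hq =>
    rw [map_add]
    exact add_mem hp hq
  | mul_X p j hp =>
    rw [map_mul]
    change _ * y j ∈ S
    generalize Ideal.Quotient.mk (markedIdeal K c c7 c13 c18 c31) p = x at hp
    induction hp using Submodule.span_induction with
    | mem x hx =>
      obtain ⟨i, rfl⟩ := hx
      exact mons_mul_var_mem c c7 c13 c18 c31 i j
    | zero => simp
    | add x z _ _ hx hz => rw [add_mul]; exact add_mem hx hz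
    | smul r x _ hx => rw [smul_mul_assoc]; exact Submodule.smul_mem _ _ hx

end Spanning

/-- For every choice of the 109 scalars, the residue classes of the 16 monomials form a
`K`-basis of `R/I_c`; in particular `dim_K R/I_c = 16`. -/
theorem markedIdeal_basis (K : Type) [Field K] [Infinite K]
    (hchar2 : ringChar K ≠ 2) (hchar3 : ringChar K ≠ 3)
    (c : Fin 21 → Fin 5 → K) (c7 c13 c18 c31 : K) :
    LinearIndependent K
      (fun i => Ideal.Quotient.mk (markedIdeal K c c7 c13 c18 c31) (mons16 K i)) ∧
    Submodule.span K
      (Set.range (fun i => Ideal.Quotient.mk (markedIdeal K c c7 c13 c18 c31) (mons16 K i)))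
      = ⊤ ∧
    Module.finrank K (MvPolynomial (Fin 7) K ⧸ markedIdeal K c c7 c13 c18 c31) = 16 := by
  have hli : LinearIndependent K
      (fun i => Ideal.Quotient.mk (markedIdeal K c c7 c13 c18 c31) (mons16 K i)) :=
    LinearIndependent.of_comp
      (Ideal.Quotient.liftₐ (markedIdeal K c c7 c13 c18 c31) (markedEval c c7 c13 c18 c31)
        (fun a ha => markedIdeal_le_ker c c7 c13 c18 c31 ha)).toLinearMap
      (linearIndependent_markedEval_mons16 c c7 c13 c18 c31)
  have hspan := monsSpan_eq_top c c7 c13 c18 c31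
  refine ⟨hli, hspan, ?_⟩
  rw [Module.finrank_eq_card_basis (Module.Basis.mk hli hspan.ge), Fintype.card_fin]
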